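/- Let S be a filter-distributive, finitary, congruential logic and A an S-algebra. An S-filter F of A is irreducible if and only if the complement A \ F is an order ideal of the poset (A, ≤). -/

import Mathlib

/-- An algebraic language: a type of function symbols with finite arities. -/
structure Lang where
  F : Type
  ar : F → ℕ

/-- An algebra for the language `L` on the carrier `A`. -/
structure AlgStr (L : Lang) (A : Type) where
  op : ∀ f : L.F, (Fin (L.ar f) → A) → A

/-- Formulas (terms) of `L` over countably many variables. -/
inductive Fm (L : Lang) : Type where
  | var : ℕ → Fm L
  | node : (f : L.F) → (Fin (L.ar f) → Fm L) → Fm L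

/-- The absolutely free algebra of formulas (the term algebra). -/
def FmAlg (L : Lang) : AlgStr L (Fm L) := ⟨Fm.node⟩

/-- Homomorphisms of algebras. -/
def IsHom {L : Lang} {A B : Type} (SA : AlgStr L A) (SB : AlgStr L B) (h : A → B) : Prop :=
  ∀ (f : L.F) (args : Fin (L.ar f) → A), h (SA.op f args) = SB.op f fun i => h (args i)

/-- A logic (deductive system) in the language `L`: a substitution-invariant
consequence relation on formulas. -/
structure Logic (L : Lang) where
  Thm : Set (Fm L) → Fm L → Prop
  refl : ∀ Γ γ, γ ∈ Γ → Thm Γ γ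
  cut : ∀ Γ Δ δ, (∀ γ ∈ Γ, Thm Δ γ) → Thm Γ δ → Thm Δ δ
  subst_inv : ∀ Γ δ (σ : Fm L → Fm L), IsHom (FmAlg L) (FmAlg L) σ →
    Thm Γ δ → Thm (σ '' Γ) (σ δ)

variable {L : Lang} {A : Type}

/-- A logic has theorems when some formula follows from the empty set. -/
def HasTheorems (S : Logic L) : Prop := ∃ δ : Fm L, S.Thm ∅ δ

/-- `S`-filters of an algebra. -/
def IsSFilter (S : Logic L) (SA : AlgStr L A) (F : Set A) : Prop :=
  ∀ h : Fm L → A, IsHom (FmAlg L) SA h →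
    ∀ (Γ : Set (Fm L)) (δ : Fm L), S.Thm Γ δ → (∀ γ ∈ Γ, h γ ∈ F) → h δ ∈ F

/-- The `S`-filter generated by a subset. -/
def Fg (S : Logic L) (SA : AlgStr L A) (B : Set A) : Set A :=
  ⋂₀ {F | IsSFilter S SA F ∧ B ⊆ F}

/-- The specialization quasiorder of an algebra. -/
def SpecLe (S : Logic L) (SA : AlgStr L A) (a b : A) : Prop :=
  Fg S SA {b} ⊆ Fg S SA {a}

/-- Congruences of an algebra. -/
def IsCongr (SA : AlgStr L A) (r : A → A → Prop) : Prop :=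
  Equivalence r ∧ ∀ (f : L.F) (x y : Fin (L.ar f) → A),
    (∀ i, r (x i) (y i)) → r (SA.op f x) (SA.op f y)

/-- A logic is congruential when the specialization equivalence is a congruence
of every algebra. -/
def Congruential (S : Logic L) : Prop :=
  ∀ (A : Type) (SA : AlgStr L A),
    IsCongr SA fun a b => SpecLe S SA a b ∧ SpecLe S SA b a

/-- `S`-algebras: the identity is the only congruence below the specialization
equivalence. -/
def IsSAlgebra (S : Logic L) (SA : AlgStr L A) : Prop :=
  ∀ r : A → A → Prop, IsCongr SA r →
    (∀ a b, r a b → SpecLe S SA a b ∧ SpecLe S SA b a) → ∀ a b, r a b → a = b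

/-- Finitary logics. -/
def Finitary (S : Logic L) : Prop :=
  ∀ (Γ : Set (Fm L)) (δ : Fm L), S.Thm Γ δ →
    ∃ Γ₀ : Finset (Fm L), ↑Γ₀ ⊆ Γ ∧ S.Thm ↑Γ₀ δ

/-- Filter-distributive logics: the lattice of `S`-filters of every algebra is
distributive. -/
def FilterDistributive (S : Logic L) : Prop :=
  ∀ (A : Type) (SA : AlgStr L A) (F G H : Set A),
    IsSFilter S SA F → IsSFilter S SA G → IsSFilter S SA H →
      F ∩ Fg S SA (G ∪ H) = Fg S SA ((F ∩ G) ∪ (F ∩ H))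

/-- `S`-ideals. -/
def IsSIdeal (S : Logic L) (SA : AlgStr L A) (I : Set A) : Prop :=
  ∀ I' : Finset A, ↑I' ⊆ I → ∀ a : A,
    (⋂ b ∈ I', Fg S SA {b}) ⊆ Fg S SA {a} → a ∈ I

/-- The strong-ideal condition. -/
def StrongIdealCond (S : Logic L) (SA : AlgStr L A) (I : Set A) : Prop :=
  ∀ I' : Finset A, ↑I' ⊆ I → ∀ B : Finset A, B.Nonempty →
    (⋂ b ∈ I', Fg S SA {b}) ⊆ Fg S SA ↑B → (Fg S SA ↑B ∩ I).Nonempty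

/-- Strong `S`-ideals. -/
def IsStrongSIdeal (S : Logic L) (SA : AlgStr L A) (I : Set A) : Prop :=
  IsSIdeal S SA I ∧ StrongIdealCond S SA I

/-- Optimal `S`-filters. -/
def IsOptimalSFilter (S : Logic L) (SA : AlgStr L A) (F : Set A) : Prop :=
  IsSFilter S SA F ∧ ∃ I : Set A, IsStrongSIdeal S SA I ∧ F ∩ I = ∅ ∧
    (∀ G, IsSFilter S SA G → G ∩ I = ∅ → F ⊆ G → G = F) ∧
    (∀ J, IsStrongSIdeal S SA J → F ∩ J = ∅ → I ⊆ J → J = I)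

/-- Irreducible `S`-filters: meet-irreducible elements of the lattice of
`S`-filters. -/
def IsIrrSFilter (S : Logic L) (SA : AlgStr L A) (F : Set A) : Prop :=
  IsSFilter S SA F ∧ F ≠ Set.univ ∧
    ∀ G H, IsSFilter S SA G → IsSFilter S SA H → F = G ∩ H → F = G ∨ F = H

/-- Order ideals of the poset `(A, ≤)` given by the specialization order. -/
def IsSpecOrderIdeal (S : Logic L) (SA : AlgStr L A) (I : Set A) : Prop :=
  I.Nonempty ∧ (∀ a ∈ I, ∀ b, SpecLe S SA b a → b ∈ I) ∧ DirectedOn (SpecLe S SA) I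

/-- Bottom families. -/
def IsBottomFamily (S : Logic L) (SA : AlgStr L A) (U : Finset A) : Prop :=
  U.Nonempty ∧ (∀ a ∈ U, ∀ b ∈ U, a ≠ b → ¬ SpecLe S SA a b) ∧
    Fg S SA ↑U = Set.univ

/-- `S`-prime subsets. -/
def IsSPrime (S : Logic L) (SA : AlgStr L A) (X : Set A) : Prop :=
  X ≠ Set.univ ∧ ∀ B : Finset A, B.Nonempty →
    (Fg S SA ↑B ∩ X).Nonempty → ((↑B : Set A) ∩ X).Nonempty

/-- Closure bases for the system of `S`-filters. -/
def IsClosureBase (S : Logic L) (SA : AlgStr L A) (𝓕 : Set (Set A)) : Prop :=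
  (∀ P ∈ 𝓕, IsSFilter S SA P) ∧
    ∀ F, IsSFilter S SA F → F = ⋂₀ {P | P ∈ 𝓕 ∧ F ⊆ P}

/-- The representation map `φ` relative to a closure base. -/
def Phi (𝓕 : Set (Set A)) (a : A) : Set (Set A) := {P | P ∈ 𝓕 ∧ a ∈ P}

/-- The extension `φ̂` of the representation map to subsets. -/
def PhiHat (𝓕 : Set (Set A)) (B : Set A) : Set (Set A) := {P | P ∈ 𝓕 ∧ B ⊆ P}

/-- The carrier of the `S`-semilattice `M(A)` relative to a closure base. -/
def MSet (𝓕 : Set (Set A)) : Set (Set (Set A)) :=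
  {U | ∃ B : Finset A, U = PhiHat 𝓕 ↑B}

/-- Filters of the meet-semilattice with carrier `MA` (ordered by inclusion,
with meet the binary intersection). -/
def IsMFilter (MA G : Set (Set (Set A))) : Prop :=
  G ⊆ MA ∧ G.Nonempty ∧ (∀ U ∈ G, ∀ V ∈ MA, U ⊆ V → V ∈ G) ∧
    ∀ U ∈ G, ∀ V ∈ G, U ∩ V ∈ G

/-- The filter of the meet-semilattice `MA` generated by a subset. -/
def MGen (MA X : Set (Set (Set A))) : Set (Set (Set A)) :=
  ⋂₀ {G | IsMFilter MA G ∧ X ⊆ G}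

/-- Frink ideals of the meet-semilattice with carrier `MA`. -/
def IsMFrinkIdeal (MA J : Set (Set (Set A))) : Prop :=
  J ⊆ MA ∧ ∀ J' : Finset (Set (Set A)), ↑J' ⊆ J → ∀ b ∈ MA,
    (∀ c ∈ MA, (∀ a ∈ J', a ⊆ c) → b ⊆ c) → b ∈ J

/-- The Frink ideal of the meet-semilattice `MA` generated by a subset. -/
def MFrinkGen (MA X : Set (Set (Set A))) : Set (Set (Set A)) :=
  ⋂₀ {J | IsMFrinkIdeal MA J ∧ X ⊆ J}

/-- `∧`-prime subsets of the meet-semilattice with carrier `MA`. -/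
def IsMPrime (MA X : Set (Set (Set A))) : Prop :=
  X ⊆ MA ∧ X ≠ MA ∧ ∀ U : Finset (Set (Set A)), U.Nonempty → ↑U ⊆ MA →
    ⋂₀ ↑U ∈ X → ∃ u ∈ U, u ∈ X

/-- Optimal filters of the meet-semilattice with carrier `MA`. -/
def IsMOptFilter (MA F : Set (Set (Set A))) : Prop :=
  IsMFilter MA F ∧ ∃ I, IsMFrinkIdeal MA I ∧ F ∩ I = ∅ ∧
    (∀ G, IsMFilter MA G → G ∩ I = ∅ → F ⊆ G → G = F) ∧
    (∀ J, IsMFrinkIdeal MA J → F ∩ J = ∅ → I ⊆ J → J = I)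

theorem isSFilter_Fg (S : Logic L) (SA : AlgStr L A) (B : Set A) :
    IsSFilter S SA (Fg S SA B) := by
  intro h hh Γ δ hδ hΓ G hG
  exact hG.1 h hh Γ δ hδ fun γ hγ => hΓ γ hγ G hG

theorem subset_Fg (S : Logic L) (SA : AlgStr L A) (B : Set A) : B ⊆ Fg S SA B :=
  fun _ hb _ hG => hG.2 hb

theorem Fg_subset {S : Logic L} {SA : AlgStr L A} {B G : Set A} (hG : IsSFilter S SA G)
    (hB : B ⊆ G) : Fg S SA B ⊆ G :=
  fun _ hx => hx G ⟨hG, hB⟩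

theorem specLe_iff_mem_Fg {S : Logic L} {SA : AlgStr L A} {a b : A} :
    SpecLe S SA a b ↔ b ∈ Fg S SA {a} :=
  ⟨fun h => h (subset_Fg S SA {b} rfl),
    fun h => Fg_subset (isSFilter_Fg S SA {a}) (Set.singleton_subset_iff.2 h)⟩

theorem IsSFilter.mem_of_specLe {S : Logic L} {SA : AlgStr L A} {G : Set A}
    (hG : IsSFilter S SA G) {a b : A} (h : SpecLe S SA a b) (ha : a ∈ G) : b ∈ G :=
  Fg_subset hG (Set.singleton_subset_iff.2 ha) (specLe_iff_mem_Fg.1 h)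

/-- In a distributive lattice of filters, `(F ∨ G) ∩ (F ∨ H) ⊆ F` as soon as `G ∩ H ⊆ F`. -/
theorem FilterDistributive.Fg_union_inter_Fg_union_subset {S : Logic L}
    (hdist : FilterDistributive S) {SA : AlgStr L A} {F G H : Set A}
    (hF : IsSFilter S SA F) (hG : IsSFilter S SA G) (hH : IsSFilter S SA H)
    (hGH : G ∩ H ⊆ F) : Fg S SA (F ∪ G) ∩ Fg S SA (F ∪ H) ⊆ F := by
  rw [hdist A SA _ F H (isSFilter_Fg S SA _) hF hH]
  refine Fg_subset hF (Set.union_subset Set.inter_subset_right ?_)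
  rw [Set.inter_comm, hdist A SA H F G hH hF hG]
  refine Fg_subset hF (Set.union_subset Set.inter_subset_right ?_)
  rwa [Set.inter_comm]

/-- For a filter-distributive, finitary, congruential logic and an `S`-algebra,
an `S`-filter is irreducible iff its complement is an order ideal of the
specialization poset. -/
theorem irreducible_iff_compl_order_ideal
    {L : Lang} (S : Logic L) {A : Type} (SA : AlgStr L A)
    (hdist : FilterDistributive S) (hfin : Finitary S)
    (hcong : Congruential S) (halg : IsSAlgebra S SA)
    (F : Set A) (hF : IsSFilter S SA F) :
    IsIrrSFilter S SA F ↔ IsSpecOrderIdeal S SA Fᶜ := by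
  constructor
  · rintro ⟨-, hne, hirr⟩
    refine ⟨Set.nonempty_compl.2 hne, fun a ha b hba hb => ha (hF.mem_of_specLe hba hb), ?_⟩
    intro a ha b hb
    have key : ¬ Fg S SA {a} ∩ Fg S SA {b} ⊆ F := by
      intro hab
      have hle {x : A} : F ⊆ Fg S SA (F ∪ Fg S SA {x}) :=
        Set.subset_union_left.trans (subset_Fg S SA _)
      have hmem {x : A} : x ∈ Fg S SA (F ∪ Fg S SA {x}) :=
        subset_Fg S SA _ (Or.inr (subset_Fg S SA {x} rfl))
      have hsub := hdist.Fg_union_inter_Fg_union_subset hF (isSFilter_Fg S SA {a})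
        (isSFilter_Fg S SA {b}) hab
      rcases hirr _ _ (isSFilter_Fg S SA _) (isSFilter_Fg S SA _)
        ((Set.subset_inter hle hle).antisymm hsub) with h | h
      · exact ha (h.superset hmem)
      · exact hb (h.superset hmem)
    obtain ⟨c, ⟨hca, hcb⟩, hc⟩ := Set.not_subset.1 key
    exact ⟨c, hc, specLe_iff_mem_Fg.2 hca, specLe_iff_mem_Fg.2 hcb⟩
  · rintro ⟨hne, -, hdir⟩
    refine ⟨hF, Set.nonempty_compl.1 hne, fun G H hG hH hGH => ?_⟩
    by_contra! hcon
    obtain ⟨g, hg, hgF⟩ := Set.not_subset.1 fun h =>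
      hcon.1 ((hGH.subset.trans Set.inter_subset_left).antisymm h)
    obtain ⟨k, hk, hkF⟩ := Set.not_subset.1 fun h =>
      hcon.2 ((hGH.subset.trans Set.inter_subset_right).antisymm h)
    obtain ⟨c, hc, hgc, hkc⟩ := hdir g hgF k hkF
    exact hc (hGH.superset ⟨hG.mem_of_specLe hgc hg, hH.mem_of_specLe hkc hk⟩)
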